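/- For every preference profile P with responsive hospital and couple preferences, there exists an individually rational matching μ such that: (a) no pair (h,s) with h ∈ H ∪ {λ} and single doctor s ∈ S blocks μ; (b) no pair ((h₁,h₂),c) with h₁, h₂ ∈ H, h₁ ≠ h₂, and couple c blocks μ; and (c) no pair ((λ,λ),c) with couple c blocks μ. -/

import Mathlib

/- A formal framework for many-to-one matching markets with couples
(hospitals/doctors), following the paper's definitions.  The dummy hospital
`λ` is modelled as `none : Option H`. -/

namespace CouplesMarket

open Finset

/-- A strict linear order on a subset `s` of `α`:  trichotomy on `s`,
irreflexivity, transitivity and asymmetry. -/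
def StrictLinearOn {α : Type} (s : Set α) (r : α → α → Prop) : Prop :=
  (∀ a ∈ s, ∀ b ∈ s, a = b ∨ r a b ∨ r b a) ∧
  (∀ a ∈ s, ¬ r a a) ∧
  (∀ a ∈ s, ∀ b ∈ s, ∀ c ∈ s, r a b → r b c → r a c) ∧
  (∀ a ∈ s, ∀ b ∈ s, r a b → ¬ r b a)

/-- A strict linear order on all of `α`. -/
def StrictLinear {α : Type} (r : α → α → Prop) : Prop :=
  StrictLinearOn Set.univ r

/-- The weak (reflexive) part `R` of a strict preference `P`. -/
def weakPref {α : Type} (r : α → α → Prop) (a b : α) : Prop := a = b ∨ r a b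

/-- A matching market: hospitals `H` with capacities `κ`, doctors `D`, and a
set of (pairwise disjoint) couples `c = (f, m)` (first component in `F`,
second in `M`; the remaining doctors are single). -/
structure Market (D H : Type) where
  κ : H → ℕ
  couples : Finset (D × D)
  couples_ne : ∀ c ∈ couples, c.1 ≠ c.2
  couples_disjoint : ∀ c ∈ couples, ∀ c' ∈ couples, c ≠ c' →
    c.1 ≠ c'.1 ∧ c.1 ≠ c'.2 ∧ c.2 ≠ c'.1 ∧ c.2 ≠ c'.2

/-- A doctor is single if he/she belongs to no couple. -/
def Market.Single {D H : Type} (M : Market D H) (d : D) : Prop :=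
  ∀ c ∈ M.couples, d ≠ c.1 ∧ d ≠ c.2

/-- A preference profile: for each hospital `h` its set `acc h = D_h` of
acceptable doctors, its linear order `rank h = P̄_h` over individual doctors,
and its preference `hpref h = P_h` over feasible sets of doctors; for each
doctor `d` an individual (resp. marginal, for couple members) preference
`dpref d = P_d` over `H ∪ {λ}`; and for each couple `c` a preference
`cpref c = P_c` over pairs in `(H ∪ {λ})²`. -/
structure Profile (D H : Type) where
  acc : H → Finset D
  rank : H → D → D → Prop
  hpref : H → Finset D → Finset D → Prop
  dpref : D → Option H → Option H → Prop
  cpref : D × D → Option H × Option H → Option H × Option H → Prop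

variable {D H : Type} [Fintype D] [DecidableEq D] [Fintype H] [DecidableEq H]

/-- Responsiveness of hospital `h`'s preference over feasible sets of doctors:
`rank h` is a linear order on `acc h`; `hpref h` is a linear order on feasible
sets; every nonempty feasible subset of acceptable doctors is preferred to `∅`;
singleton comparisons agree with `rank h`; adding a common acceptable doctor to
two feasible subsets of acceptable doctors preserves their comparison; and `∅`
is preferred to every feasible set not contained in `acc h`. -/
def HospResponsive (M : Market D H) (P : Profile D H) (h : H) : Prop :=
  StrictLinearOn {d | d ∈ P.acc h} (P.rank h) ∧
  StrictLinearOn {A : Finset D | A.card ≤ M.κ h} (P.hpref h) ∧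
  (∀ A : Finset D, A ⊆ P.acc h → A.Nonempty → A.card ≤ M.κ h → P.hpref h A ∅) ∧
  (∀ d ∈ P.acc h, ∀ d' ∈ P.acc h, d ≠ d' → (P.hpref h {d} {d'} ↔ P.rank h d d')) ∧
  (∀ A B : Finset D, A ⊆ P.acc h → B ⊆ P.acc h → A.card < M.κ h → B.card < M.κ h →
      ∀ d ∈ P.acc h, d ∉ A → d ∉ B →
        (P.hpref h (insert d A) (insert d B) ↔ P.hpref h A B)) ∧
  (∀ A : Finset D, A.card ≤ M.κ h → ¬ A ⊆ P.acc h → P.hpref h ∅ A)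

/-- Responsiveness of a couple's preference over pairs of hospitals with
respect to the induced marginal preferences of its two members. -/
def CoupleResponsive (P : Profile D H) (c : D × D) : Prop :=
  StrictLinear (P.cpref c) ∧ StrictLinear (P.dpref c.1) ∧ StrictLinear (P.dpref c.2) ∧
  (∀ h h₁ h₂ : Option H,
    (P.cpref c (h₁, h) (h₂, h) ↔ P.dpref c.1 h₁ h₂) ∧
    (P.cpref c (h, h₁) (h, h₂) ↔ P.dpref c.2 h₁ h₂))

/-- A fully responsive preference profile. -/
def Responsive (M : Market D H) (P : Profile D H) : Prop :=
  (∀ h : H, HospResponsive M P h) ∧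
  (∀ c ∈ M.couples, CoupleResponsive P c) ∧
  (∀ d : D, M.Single d → StrictLinear (P.dpref d))

/-- A matching: each doctor is assigned a hospital in `H ∪ {λ}` (where `none`
means unemployed), respecting capacities.  (Disjointness of the hospitals'
sets of doctors is automatic, and the dummy hospital has capacity `|D|`.) -/
structure Matching {D H : Type} [Fintype D] [DecidableEq D] [DecidableEq H]
    (M : Market D H) : Type where
  assign : D → Option H
  quota : ∀ h : H, (Finset.univ.filter fun d => assign d = some h).card ≤ M.κ h

/-- `μ(h)`, the set of doctors matched with hospital `h`. -/
def Matching.assigned {M : Market D H} (μ : Matching M) (h : H) : Finset D :=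
  Finset.univ.filter fun d => μ.assign d = some h

/-- Hospital `h ∈ H ∪ {λ}` prefers the set of doctors `A` to (a subset of) its
assignment at `μ`: there is `B ⊆ μ(h)` disjoint from `A` such that the feasible
set `(μ(h) \ B) ∪ A` is preferred to `μ(h)`.  The dummy hospital always
prefers to have any doctors. -/
def HosPrefers (M : Market D H) (P : Profile D H) (μ : Matching M) :
    Option H → Finset D → Prop
  | none, _ => True
  | some h, A => ∃ B ⊆ μ.assigned h, Disjoint A B ∧
      ((μ.assigned h \ B) ∪ A).card ≤ M.κ h ∧
      P.hpref h ((μ.assigned h \ B) ∪ A) (μ.assigned h)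

/-- The pair `(h, s)` (hospital or dummy, single doctor) blocks `μ`. -/
def BlocksSingle (M : Market D H) (P : Profile D H) (μ : Matching M)
    (h : Option H) (s : D) : Prop :=
  P.dpref s h (μ.assign s) ∧ HosPrefers M P μ h {s}

/-- The pair `((h_f, h_m), c)` (pair of hospitals or dummies, couple `c = (f, m)`)
blocks `μ`. -/
def BlocksCouple (M : Market D H) (P : Profile D H) (μ : Matching M)
    (hf hm : Option H) (c : D × D) : Prop :=
  P.cpref c (hf, hm) (μ.assign c.1, μ.assign c.2) ∧
  (hf ≠ hm → μ.assign c.1 ≠ hf → HosPrefers M P μ hf {c.1}) ∧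
  (hf ≠ hm → μ.assign c.2 ≠ hm → HosPrefers M P μ hm {c.2}) ∧
  (hf = hm → HosPrefers M P μ hf {c.1, c.2})

/-- Stability: no single blocking pair, no couple blocking pair, and no
hospital prefers `∅` to its assignment. -/
def Stable (M : Market D H) (P : Profile D H) (μ : Matching M) : Prop :=
  (∀ (h : Option H) (s : D), M.Single s → ¬ BlocksSingle M P μ h s) ∧
  (∀ (hf hm : Option H), ∀ c ∈ M.couples, ¬ BlocksCouple M P μ hf hm c) ∧
  (∀ h : H, ¬ HosPrefers M P μ (some h) ∅)

/-- Individual rationality. -/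
def IndivRational (M : Market D H) (P : Profile D H) (μ : Matching M) : Prop :=
  (∀ s : D, M.Single s → weakPref (P.dpref s) (μ.assign s) none) ∧
  (∀ c ∈ M.couples, weakPref (P.cpref c) (μ.assign c.1, μ.assign c.2) (none, none)) ∧
  (∀ h : H, ∀ d ∈ μ.assigned h, d ∈ P.acc h)

/-- Extreme-altruism of the profile of couple preferences: for every couple
`c = (f, m)`, every hospital `h` with `κ_h ≤ |D| - 2` and all
`h', h'' ∈ H ∪ {λ}`:  (i) `h' P_f h`, `h' R_f h''` and `h'' R_m λ` imply
`(h', h'') P_c (h, h)`; and (ii) symmetrically for `m`. -/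
def ExtremeAltruism (M : Market D H) (P : Profile D H) : Prop :=
  ∀ c ∈ M.couples, ∀ h : H, M.κ h ≤ Fintype.card D - 2 →
    ∀ h' h'' : Option H,
      ((P.dpref c.1 h' (some h) ∧ weakPref (P.dpref c.1) h' h'' ∧
          weakPref (P.dpref c.2) h'' none) →
        P.cpref c (h', h'') (some h, some h)) ∧
      ((P.dpref c.2 h' (some h) ∧ weakPref (P.dpref c.2) h' h'' ∧
          weakPref (P.dpref c.1) h'' none) →
        P.cpref c (h'', h') (some h, some h))

/-- Aversion to couple diversity of the profile of hospital preferences: for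
every hospital `h`, every couple `c = (f, m)` of acceptable doctors and all
doctors `d₁, d₂` ranked strictly in between `f` and `m` by `h`, if more than
`κ_h` doctors are ranked above the worse member of the couple then
`{d₁, d₂} P_h {f, m}`. -/
def AversionToCoupleDiversity (M : Market D H) (P : Profile D H) : Prop :=
  ∀ h : H, ∀ c ∈ M.couples, c.1 ∈ P.acc h → c.2 ∈ P.acc h → ∀ d₁ d₂ : D,
    ((P.rank h c.1 d₁ ∧ P.rank h d₁ d₂ ∧ P.rank h d₂ c.2 ∧
        M.κ h < {d : D | P.rank h d c.2}.ncard) ∨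
     (P.rank h c.2 d₁ ∧ P.rank h d₁ d₂ ∧ P.rank h d₂ c.1 ∧
        M.κ h < {d : D | P.rank h d c.1}.ncard)) →
    P.hpref h {d₁, d₂} {c.1, c.2}

/-- `P` is an extension of the profile `P₀` of couple preferences: the couple
preferences (and hence their induced marginals) agree with `P₀`. -/
def CoupleExtension (M : Market D H) (P₀ P : Profile D H) : Prop :=
  ∀ c ∈ M.couples, P.cpref c = P₀.cpref c ∧
    P.dpref c.1 = P₀.dpref c.1 ∧ P.dpref c.2 = P₀.dpref c.2

/-- `P` is an extension of the profile `P₀` of hospital preferences: the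
hospital preferences (including the sets of acceptable doctors) agree with `P₀`. -/
def HospitalExtension (P₀ P : Profile D H) : Prop :=
  ∀ h : H, P.acc h = P₀.acc h ∧ P.rank h = P₀.rank h ∧ P.hpref h = P₀.hpref h

end CouplesMarket

namespace CouplesMarket

theorem StrictLinear.exists_best {α : Type} [Finite α] {r : α → α → Prop} (hr : StrictLinear r)
    (s : Set α) (hs : s.Nonempty) : ∃ a ∈ s, ∀ b ∈ s, weakPref r a b := by
  obtain ⟨htri, hirr, htrans, -⟩ := hr
  have : IsTrans α r := ⟨fun a b c => htrans a trivial b trivial c trivial⟩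
  have : Std.Irrefl r := ⟨fun a => hirr a trivial⟩
  obtain ⟨a, ha, hmin⟩ := (Finite.wellFounded_of_trans_of_irrefl r).has_min s hs
  refine ⟨a, ha, fun b hb => ?_⟩
  rcases htri a trivial b trivial with h | h | h
  · exact Or.inl h
  · exact Or.inr h
  · exact absurd h (hmin b hb)

theorem StrictLinearOn.exists_worst {α : Type} [Finite α] {t : Set α} {r : α → α → Prop}
    (hr : StrictLinearOn t r) (s : Set α) (hst : s ⊆ t) (hs : s.Nonempty) :
    ∃ a ∈ s, ∀ b ∈ s, weakPref r b a := by
  obtain ⟨htri, hirr, htrans, -⟩ := hr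
  let r' : α → α → Prop := fun a b => a ∈ t ∧ b ∈ t ∧ r b a
  have : IsTrans α r' :=
    ⟨fun a b c hab hbc => ⟨hab.1, hbc.2.1, htrans c hbc.2.1 b hab.2.1 a hab.1 hbc.2.2 hab.2.2⟩⟩
  have : Std.Irrefl r' := ⟨fun a h => hirr a h.1 h.2.2⟩
  obtain ⟨a, ha, hmin⟩ := (Finite.wellFounded_of_trans_of_irrefl r').has_min s hs
  refine ⟨a, ha, fun b hb => ?_⟩
  rcases htri b (hst hb) a (hst ha) with h | h | h
  · exact Or.inl h
  · exact Or.inr h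
  · exact absurd ⟨hst hb, hst ha, h⟩ (hmin b hb)

section DeferredAcceptance

variable {D H : Type} (κ : H → ℕ) (acc : H → Finset D) (rank : H → D → D → Prop)
  (dpref : D → Option H → Option H → Prop)

/-- The acceptable doctors proposing to `h` at `p` whom `h` ranks above `d`. -/
def betterProposers (p : D → Option H) (h : H) (d : D) : Set D :=
  {d' | p d' = some h ∧ d' ∈ acc h ∧ rank h d' d}

/-- A state of deferred acceptance: doctors propose to the options `p`, nobody proposes to a
hospital worse than unemployment, and whenever `d` proposes to an option worse than `h`, then `d`
is unacceptable to `h` or `h` has `κ h` better proposers. -/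
def IsProposalState (p : D → Option H) : Prop :=
  (∀ d, weakPref (dpref d) (p d) none) ∧
  ∀ d h, dpref d (some h) (p d) → d ∈ acc h → κ h ≤ (betterProposers acc rank p h d).ncard

variable {κ acc rank dpref} [Finite H]

theorem exists_isProposalState (hd : ∀ d, StrictLinear (dpref d)) :
    ∃ p, IsProposalState κ acc rank dpref p := by
  choose p _ hp using fun d => (hd d).exists_best Set.univ ⟨none, trivial⟩
  refine ⟨p, fun d => hp d _ trivial, fun d h hdh _ => ?_⟩
  rcases hp d (some h) trivial with h' | h'
  · exact absurd (h' ▸ hdh) ((hd d).2.1 _ trivial)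
  · exact absurd h' ((hd d).2.2.2 _ trivial _ trivial hdh)

variable [Finite D]

/-- If `h` can reject the proposer `d`, then `d` can move on to the next best option. -/
theorem IsProposalState.exists_reject (hd : ∀ d, StrictLinear (dpref d))
    (hrank : ∀ h, StrictLinearOn {d | d ∈ acc h} (rank h))
    {p : D → Option H} (hp : IsProposalState κ acc rank dpref p) {d : D} {h : H}
    (hdh : p d = some h)
    (hrej : d ∈ acc h → κ h ≤ (betterProposers acc rank p h d).ncard) :
    ∃ p', IsProposalState κ acc rank dpref p' ∧
      (∀ d', weakPref (dpref d') (p d') (p' d')) ∧ dpref d (p d) (p' d) := by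
  classical
  have hnone : dpref d (p d) none := by
    rcases hp.1 d with h' | h'
    · rw [hdh] at h'; cases h'
    · exact h'
  obtain ⟨q, hq, hbest⟩ := (hd d).exists_best {o | dpref d (p d) o} ⟨none, hnone⟩
  have hqp : q ≠ p d := by
    rintro rfl
    exact (hd d).2.1 _ trivial hq
  -- A set of better proposers can only lose `d`.
  have hsub : ∀ h' d', d ∉ betterProposers acc rank p h' d' →
      betterProposers acc rank p h' d' ⊆
        betterProposers acc rank (Function.update p d q) h' d' := by
    intro h' d' hn e he
    have hed : e ≠ d := fun hed => hn (hed ▸ he)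
    exact ⟨by rw [Function.update_of_ne hed]; exact he.1, he.2⟩
  have hself : d ∉ betterProposers acc rank p h d := fun h' => (hrank h).2.1 d h'.2.1 h'.2.2
  have hcount : ∀ h' d', d' ∈ acc h' → κ h' ≤ (betterProposers acc rank p h' d').ncard →
      κ h' ≤ (betterProposers acc rank (Function.update p d q) h' d').ncard := by
    intro h' d' hacc hle
    by_cases hn : d ∈ betterProposers acc rank p h' d'
    · obtain rfl : h = h' := Option.some_injective _ (hdh.symm.trans hn.1)
      refine (hrej hn.2.1).trans (Set.ncard_le_ncard ((hsub _ _ hself).trans ?_) (Set.toFinite _))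
      exact fun e he => ⟨he.1, he.2.1,
        (hrank h).2.2.1 e he.2.1 d hn.2.1 d' hacc he.2.2 hn.2.2⟩
    · exact hle.trans (Set.ncard_le_ncard (hsub _ _ hn) (Set.toFinite _))
  refine ⟨Function.update p d q, ⟨fun d' => ?_, fun d' h' hpref hacc => ?_⟩, fun d' => ?_, ?_⟩
  · by_cases hdd : d' = d
    · subst hdd
      simpa using hbest none hnone
    · simpa [hdd] using hp.1 d'
  · refine hcount h' d' hacc ?_
    by_cases hdd : d' = d
    · subst hdd
      rw [Function.update_self] at hpref
      rcases (hd d').1 (some h') trivial (p d') trivial with h1 | h1 | h1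
      · obtain rfl : h = h' := Option.some_injective _ (hdh.symm.trans h1.symm)
        exact hrej hacc
      · exact hp.2 d' h' h1 hacc
      · rcases hbest _ h1 with h2 | h2
        · exact absurd (h2 ▸ hpref) ((hd d').2.1 _ trivial)
        · exact absurd h2 ((hd d').2.2.2 _ trivial _ trivial hpref)
    · rw [Function.update_of_ne hdd] at hpref
      exact hp.2 d' h' hpref hacc
  · by_cases hdd : d' = d
    · subst hdd
      exact Or.inr (by simpa using hq)
    · exact Or.inl (by simp [hdd])
  · simpa using hq

/-- Existence of stable many-to-one matchings without couples (Gale–Shapley). -/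
theorem exists_isProposalState_feasible (hd : ∀ d, StrictLinear (dpref d))
    (hrank : ∀ h, StrictLinearOn {d | d ∈ acc h} (rank h)) :
    ∃ p, IsProposalState κ acc rank dpref p ∧ (∀ d h, p d = some h → d ∈ acc h) ∧
      ∀ h, {d | p d = some h}.ncard ≤ κ h := by
  let r : (D → Option H) → (D → Option H) → Prop := fun p' p =>
    (∀ d, weakPref (dpref d) (p d) (p' d)) ∧ ∃ d, dpref d (p d) (p' d)
  have : IsTrans _ r := ⟨by
    rintro a b c ⟨hab, -⟩ ⟨hbc, d, hdd⟩
    refine ⟨fun e => ?_, d, ?_⟩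
    · rcases hbc e with h1 | h1
      · rw [h1]; exact hab e
      · rcases hab e with h2 | h2
        · rw [← h2]; exact Or.inr h1
        · exact Or.inr ((hd e).2.2.1 _ trivial _ trivial _ trivial h1 h2)
    · rcases hab d with h2 | h2
      · rw [← h2]; exact hdd
      · exact (hd d).2.2.1 _ trivial _ trivial _ trivial hdd h2⟩
  have : Std.Irrefl r := ⟨fun a ⟨_, d, h⟩ => (hd d).2.1 _ trivial h⟩
  obtain ⟨p, hp, hmin⟩ := (Finite.wellFounded_of_trans_of_irrefl r).has_min
    {p | IsProposalState κ acc rank dpref p} (exists_isProposalState hd)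
  have hno : ∀ d h, p d = some h →
      ¬ (d ∈ acc h → κ h ≤ (betterProposers acc rank p h d).ncard) := by
    intro d h hdh hrej
    obtain ⟨p', hp', hle, hlt⟩ := hp.exists_reject hd hrank hdh hrej
    exact hmin p' hp' ⟨hle, d, hlt⟩
  have hacc : ∀ d h, p d = some h → d ∈ acc h := by
    intro d h hdh
    by_contra hn
    exact hno d h hdh fun h' => absurd h' hn
  refine ⟨p, hp, hacc, fun h => ?_⟩
  by_contra! hlt
  obtain ⟨d, hdh, hworst⟩ := (hrank h).exists_worst {d | p d = some h} (fun d => hacc d h)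
    (Set.nonempty_of_ncard_ne_zero (by omega))
  refine hno d h hdh fun _ => ?_
  have hsub : {d | p d = some h} \ {d} ⊆ betterProposers acc rank p h d := by
    rintro e ⟨he, hed⟩
    exact ⟨he, hacc e h he, (hworst e he).resolve_left hed⟩
  have h1 := Set.ncard_le_ncard hsub (Set.toFinite _)
  have h2 := Set.ncard_sdiff_singleton_of_mem (s := {d | p d = some h}) hdh
  omega

end DeferredAcceptance

section HospitalPreferences

variable {D H : Type} [DecidableEq D] {M : Market D H} {P : Profile D H} {h : H}

theorem HospResponsive.union_pref_iff (hr : HospResponsive M P h) {A B C : Finset D}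
    (hA : A ⊆ P.acc h) (hB : B ⊆ P.acc h) (hC : C ⊆ P.acc h)
    (hAC : Disjoint A C) (hBC : Disjoint B C)
    (hcA : (C ∪ A).card ≤ M.κ h) (hcB : (C ∪ B).card ≤ M.κ h) :
    P.hpref h (C ∪ A) (C ∪ B) ↔ P.hpref h A B := by
  induction C using Finset.induction_on with
  | empty => simp
  | insert d C hdC ih =>
    rw [Finset.disjoint_insert_right] at hAC hBC
    rw [Finset.insert_subset_iff] at hC
    rw [Finset.insert_union] at hcA hcB
    have hdA : d ∉ C ∪ A := by simp [hdC, hAC.1]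
    have hdB : d ∉ C ∪ B := by simp [hdC, hBC.1]
    rw [Finset.card_insert_of_notMem hdA] at hcA
    rw [Finset.card_insert_of_notMem hdB] at hcB
    rw [Finset.insert_union, Finset.insert_union,
      hr.2.2.2.2.1 _ _ (Finset.union_subset hC.2 hA) (Finset.union_subset hC.2 hB)
        (by omega) (by omega) d hC.1 hdA hdB]
    exact ih hC.2 hAC.2 hBC.2 (by omega) (by omega)

/-- A nonempty set of doctors all ranked above `d` is preferred to `{d}`. -/
theorem HospResponsive.pref_singleton (hr : HospResponsive M P h) {B : Finset D} {d : D}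
    (hd : d ∈ P.acc h) (hB : B ⊆ P.acc h) (hne : B.Nonempty) (hcB : B.card ≤ M.κ h)
    (hbetter : ∀ b ∈ B, P.rank h b d) : P.hpref h B {d} := by
  obtain ⟨b, hb⟩ := hne
  have hbacc := hB hb
  have hpos : 0 < B.card := Finset.card_pos.2 ⟨b, hb⟩
  have hbd : P.hpref h {b} {d} := by
    refine (hr.2.2.2.1 b hbacc d hd ?_).2 (hbetter b hb)
    rintro rfl
    exact hr.1.2.1 b hd (hbetter b hb)
  rcases (B.erase b).eq_empty_or_nonempty with he | he
  · rw [← Finset.insert_erase hb, he]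
    simpa using hbd
  · have hcard := Finset.card_erase_of_mem hb
    have hsub : B.erase b ⊆ P.acc h := (Finset.erase_subset _ _).trans hB
    have h0 : P.hpref h (B.erase b) ∅ := hr.2.2.1 _ hsub he (by omega)
    have h1 := (hr.2.2.2.2.1 (B.erase b) ∅ hsub (by simp) (by omega)
      (by simp; omega) b hbacc (by simp) (by simp)).2 h0
    rw [Finset.insert_erase hb] at h1
    exact hr.2.1.2.2.1 B hcB {b} (by simp; omega) {d} (by simp; omega) h1 hbd

variable [Fintype D] [DecidableEq H]

/-- A full hospital all of whose doctors are ranked above `d` does not want `d`, and no hospital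
wants an unacceptable doctor. -/
theorem HospResponsive.not_hosPrefers_singleton (hr : HospResponsive M P h) {μ : Matching M}
    (hacc : μ.assigned h ⊆ P.acc h) {d : D} (hd : d ∉ μ.assigned h)
    (hfull : d ∈ P.acc h →
      M.κ h ≤ (μ.assigned h).card ∧ ∀ b ∈ μ.assigned h, P.rank h b d) :
    ¬ HosPrefers M P μ (some h) {d} := by
  rintro ⟨B, hB, hdB, hcard, hpref⟩
  have hq : (μ.assigned h).card ≤ M.κ h := μ.quota h
  by_cases hda : d ∈ P.acc h
  · obtain ⟨hκ, hbetter⟩ := hfull hda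
    have hdC : Disjoint {d} (μ.assigned h \ B) := by simp [hd]
    have hne : B.Nonempty := by
      rw [Finset.nonempty_iff_ne_empty]
      rintro rfl
      rw [Finset.card_union_of_disjoint hdC.symm, Finset.sdiff_empty,
        Finset.card_singleton] at hcard
      omega
    have hcB := (Finset.card_le_card hB).trans hq
    have hunion : μ.assigned h \ B ∪ B = μ.assigned h := Finset.sdiff_union_of_subset hB
    have hlt : P.hpref h B {d} := hr.pref_singleton hda (hB.trans hacc) hne hcB
      fun b hb => hbetter b (hB hb)
    have h1 : P.hpref h {d} B := by
      refine (hr.union_pref_iff (by simpa using hda) (hB.trans hacc)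
        (Finset.sdiff_subset.trans hacc) hdC Finset.disjoint_sdiff hcard
        (by rw [hunion]; exact hq)).1 ?_
      rwa [hunion]
    have hpos : 0 < B.card := Finset.card_pos.2 hne
    exact hr.2.1.2.2.2 B hcB {d} (by simp; omega) hlt h1
  · have h1 : P.hpref h ∅ (μ.assigned h \ B ∪ {d}) :=
      hr.2.2.2.2.2 _ hcard fun hs => hda (hs (by simp))
    have h2 := hr.2.1.2.2.1 ∅ (by simp) _ hcard _ hq h1 hpref
    rcases (μ.assigned h).eq_empty_or_nonempty with he | he
    · rw [he] at h2
      exact hr.2.1.2.1 ∅ (by simp) h2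
    · exact hr.2.1.2.2.2 ∅ (by simp) _ hq h2 (hr.2.2.1 _ hacc he hq)

end HospitalPreferences

/-- Componentwise weak improvements are weak improvements for a couple. -/
theorem CoupleResponsive.weakPref_of_weakPref {D H : Type} {P : Profile D H} {c : D × D}
    (hc : CoupleResponsive P c) {a b a' b' : Option H} (h1 : weakPref (P.dpref c.1) a a')
    (h2 : weakPref (P.dpref c.2) b b') : weakPref (P.cpref c) (a, b) (a', b') := by
  rcases h1 with rfl | h1
  · rcases h2 with rfl | h2
    · exact Or.inl rfl
    · exact Or.inr ((hc.2.2.2 _ _ _).2.2 h2)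
  · have h1' := (hc.2.2.2 b _ _).1.2 h1
    rcases h2 with rfl | h2
    · exact Or.inr h1'
    · exact Or.inr (hc.1.2.2.1 _ trivial _ trivial _ trivial h1' ((hc.2.2.2 _ _ _).2.2 h2))

theorem StrictLinear.not_of_weakPref {α : Type} {r : α → α → Prop} (hr : StrictLinear r) {a b : α}
    (h : weakPref r a b) : ¬ r b a := by
  rcases h with rfl | h
  · exact hr.2.1 _ trivial
  · exact hr.2.2.2 _ trivial _ trivial h

theorem StrictLinear.weakPref_of_not {α : Type} {r : α → α → Prop} (hr : StrictLinear r) {a b : α}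
    (h : ¬ r b a) : weakPref r a b := by
  rcases hr.1 a trivial b trivial with h' | h' | h'
  · exact Or.inl h'
  · exact Or.inr h'
  · exact absurd h' h

theorem Responsive.strictLinear_dpref {D H : Type} [Fintype D] [DecidableEq D] {M : Market D H}
    {P : Profile D H} (hresp : Responsive M P) (d : D) : StrictLinear (P.dpref d) := by
  by_cases hs : M.Single d
  · exact hresp.2.2 d hs
  · simp only [Market.Single, not_forall] at hs
    obtain ⟨c, hc, hdc⟩ := hs
    by_cases h1 : d = c.1
    · exact h1 ▸ (hresp.2.1 c hc).2.1
    · have h2 : d = c.2 := by tauto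
      exact h2 ▸ (hresp.2.1 c hc).2.2.1

/-- For every responsive profile there is an individually rational matching
that is blocked neither by a pair `(h, s)` with `s` single, nor by
`((h₁, h₂), c)` with `h₁ ≠ h₂`, nor by `((λ, λ), c)`. -/
theorem exists_matching_no_single_block_no_distinct_pair_block
    {D H : Type} [Fintype D] [DecidableEq D] [Fintype H] [DecidableEq H]
    (M : Market D H) (hκ : ∀ h : H, 2 ≤ M.κ h)
    (P : Profile D H) (hresp : Responsive M P) :
    ∃ μ : Matching M, IndivRational M P μ ∧
      (∀ (h : Option H) (s : D), M.Single s → ¬ BlocksSingle M P μ h s) ∧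
      (∀ h₁ h₂ : H, h₁ ≠ h₂ → ∀ c ∈ M.couples,
        ¬ BlocksCouple M P μ (some h₁) (some h₂) c) ∧
      (∀ c ∈ M.couples, ¬ BlocksCouple M P μ none none c) := by
  have hd := hresp.strictLinear_dpref
  obtain ⟨p, ⟨hir, hstab⟩, hacc, hquota⟩ := exists_isProposalState_feasible (κ := M.κ)
    (acc := P.acc) (rank := P.rank) hd fun h => (hresp.1 h).1
  let μ : Matching M := ⟨p, fun h => by
    rw [← Set.ncard_coe_finset]
    simpa using hquota h⟩
  have hmem : ∀ h d, d ∈ μ.assigned h ↔ p d = some h := fun h d => by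
    simp [Matching.assigned, μ]
  have hnp : ∀ d h, P.dpref d (some h) (p d) → ¬ HosPrefers M P μ (some h) {d} := by
    intro d h hdh
    refine (hresp.1 h).not_hosPrefers_singleton (fun e he => hacc e h ((hmem h e).1 he)) ?_ ?_
    · rw [hmem]
      intro he
      exact (hd d).2.1 _ trivial (he ▸ hdh)
    · intro hda
      have hle := hstab d h hdh hda
      have hsub : betterProposers P.acc P.rank p h d ⊆ (μ.assigned h : Set D) :=
        fun e he => (hmem h e).2 he.1
      have hcard := Set.ncard_le_ncard hsub (Set.toFinite _)
      have hq : (μ.assigned h).card ≤ M.κ h := μ.quota h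
      rw [Set.ncard_coe_finset] at hcard
      have heq : betterProposers P.acc P.rank p h d = (μ.assigned h : Set D) :=
        Set.eq_of_subset_of_ncard_le hsub (by rw [Set.ncard_coe_finset]; omega) (Set.toFinite _)
      refine ⟨by omega, fun b hb => ?_⟩
      have hb' : b ∈ betterProposers P.acc P.rank p h d := heq ▸ hb
      exact hb'.2.2
  have hcir : ∀ c ∈ M.couples, weakPref (P.cpref c) (p c.1, p c.2) (none, none) :=
    fun c hc => (hresp.2.1 c hc).weakPref_of_weakPref (hir c.1) (hir c.2)
  refine ⟨μ, ⟨fun s _ => hir s, hcir, fun h d hdh => hacc d h ((hmem h d).1 hdh)⟩, ?_, ?_, ?_⟩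
  · rintro (_ | h) s - ⟨hpref, hhos⟩
    · exact (hd s).not_of_weakPref (hir s) hpref
    · exact hnp s h hpref hhos
  · rintro h₁ h₂ hne c hc ⟨hpref, hf, hm, -⟩
    have hne' : (some h₁ : Option H) ≠ some h₂ := fun h => hne (Option.some_injective _ h)
    have key : ∀ d h, (μ.assign d ≠ some h → HosPrefers M P μ (some h) {d}) →
        weakPref (P.dpref d) (p d) (some h) := by
      refine fun d h hdh => (hd d).weakPref_of_not fun hlt => hnp d h hlt (hdh fun he => ?_)
      exact (hd d).2.1 _ trivial ((show p d = some h from he) ▸ hlt)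
    exact (hresp.2.1 c hc).1.not_of_weakPref ((hresp.2.1 c hc).weakPref_of_weakPref
      (key c.1 h₁ (hf hne')) (key c.2 h₂ (hm hne'))) hpref
  · rintro c hc ⟨hpref, -⟩
    exact (hresp.2.1 c hc).1.not_of_weakPref (hcir c hc) hpref

end CouplesMarket
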